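/- Let G be a finite group, a,b positive integers, and Γ = ⟨x, y | x^a = y^b⟩. Then |Hom(Γ, G)| / |G| = Σ_χ ν_a(χ)·ν_b(χ), where ν_n(χ) = (1/|G|) Σ_{x∈G} χ(x^n) is the n-th Frobenius–Schur indicator and the sum runs over irreducible complex characters of G. -/

import Mathlib

open CategoryTheory

/-- The set of irreducible complex characters of a finite group `G`. -/
def irredChars (G : Type) [Group G] : Set (G → ℂ) :=
  {f | ∃ V : FDRep ℂ G, Simple V ∧ f = V.character}

open scoped MonoidAlgebra in
/-- A central group algebra element with zero trace on an irreducible representation acts by zero. -/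
lemma aux_schur {G V : Type} [Group G] [Fintype G] [AddCommGroup V] [Module ℂ V]
    [FiniteDimensional ℂ V] (ρ : Representation ℂ G V) [ρ.IsIrreducible] (f : G → ℂ)
    (hf : ∀ g h : G, f (h * g * h⁻¹) = f g) (h0 : ∑ g, f g * ρ.character g = 0) :
    ∑ g, f g • ρ g = 0 := by
  have hcomm : ∀ h : G, (∑ g, f g • ρ g) ∘ₗ ρ h = ρ h ∘ₗ (∑ g, f g • ρ g) := by
    intro h
    change (∑ g, f g • ρ g) * ρ h = ρ h * (∑ g, f g • ρ g)
    rw [Finset.sum_mul, Finset.mul_sum]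
    symm
    refine Fintype.sum_equiv (MulAut.conj h).toEquiv _ _ fun g => ?_
    simp only [MulEquiv.toEquiv_eq_coe, MulEquiv.coe_toEquiv, MulAut.conj_apply, hf]
    rw [mul_smul_comm, smul_mul_assoc, ← map_mul, ← map_mul]
    simp
  let T : Representation.IntertwiningMap ρ ρ := ⟨∑ g, f g • ρ g, hcomm⟩
  obtain ⟨c, hc⟩ :=
    (Representation.IsIrreducible.algebraMap_intertwiningMap_bijective_of_isAlgClosed
      (ρ := ρ)).2 T
  have hc' : ∑ g, f g • ρ g = c • (LinearMap.id : V →ₗ[ℂ] V) := by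
    have : T.toLinearMap = (algebraMap ℂ (Representation.IntertwiningMap ρ ρ) c).toLinearMap := by
      rw [hc]
    exact this
  have ht := congrArg (LinearMap.trace ℂ V) hc'
  rw [map_sum] at ht
  simp only [map_smul, smul_eq_mul, LinearMap.trace_id] at ht
  have h0' : ∑ g, f g * LinearMap.trace ℂ V (ρ g) = 0 := h0
  rw [h0'] at ht
  have hnt : Nontrivial V := IsSimpleModule.nontrivial ℂ[G] ρ.asModule
  have hd : (Module.finrank ℂ V : ℂ) ≠ 0 := by
    exact_mod_cast (Module.finrank_pos (R := ℂ) (M := V)).ne'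
  have : c = 0 := by
    rcases mul_eq_zero.mp ht.symm with h | h
    · exact h
    · exact absurd h hd
  rw [hc', this, zero_smul]

lemma aux_mem {G V : Type} [Group G] [Fintype G] [AddCommGroup V] [Module ℂ V]
    [FiniteDimensional ℂ V] (ρ : Representation ℂ G V) [ρ.IsIrreducible] :
    ρ.character ∈ irredChars G := by
  have := invertibleOfNonzero (NeZero.ne (Nat.card G : ℂ))
  refine ⟨FDRep.of ρ, ?_, rfl⟩
  rw [FDRep.simple_iff_char_is_norm_one]
  have h := Representation.char_orthonormal ρ ρ
  rw [if_pos ⟨Representation.Equiv.refl ρ⟩] at h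
  have hne : (Nat.card G : ℂ) ≠ 0 := NeZero.ne _
  change ∑ g, ρ.character g * ρ.character g⁻¹ = _
  field_simp at h
  simpa using h

open scoped MonoidAlgebra in
lemma aux_simple {G : Type} [Group G] [Fintype G] (f : G → ℂ)
    (hf : ∀ g h : G, f (h * g * h⁻¹) = f g)
    (h0 : ∀ χ ∈ irredChars G, ∑ g, f g * χ g = 0)
    (S : Type) [AddCommGroup S] [Module ℂ S] [Module ℂ[G] S] [IsScalarTower ℂ ℂ[G] S]
    [hS : IsSimpleModule ℂ[G] S]
    (s : S) : (∑ g, MonoidAlgebra.single g (f g) : ℂ[G]) • s = 0 := by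
  let ρ : Representation ℂ G S := Representation.ofModule' S
  have hρ : ∀ (r : ℂ[G]) (x : S), ρ.asAlgebraHom r x = r • x := by
    intro r x
    have : ρ.asAlgebraHom = Algebra.lsmul ℂ ℂ S := by
      simp [ρ, Representation.ofModule', Representation.asAlgebraHom]
    rw [this]; rfl
  have : ρ.IsIrreducible := by
    rw [Representation.irreducible_iff_isSimpleModule_asModule]
    let e : ρ.asModule ≃ₗ[ℂ[G]] S :=
      { ρ.asModuleEquiv.toAddEquiv with
        map_smul' := fun r x => hρ r x }
    exact IsSimpleModule.congr e
  have : Module.Finite ℂ ℂ[G] := inferInstance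
  have : FiniteDimensional ℂ S := Module.Finite.trans ℂ[G] _
  have h := aux_schur ρ f hf (h0 _ (aux_mem ρ))
  have hz : ρ.asAlgebraHom (∑ g, MonoidAlgebra.single g (f g) : ℂ[G]) = 0 := by
    rw [← h]
    simp only [map_sum, Representation.asAlgebraHom_single]
  rw [← hρ, hz]; rfl

open scoped MonoidAlgebra in
lemma aux_complete {G : Type} [Group G] [Fintype G] (f : G → ℂ)
    (hf : ∀ g h : G, f (h * g * h⁻¹) = f g)
    (h0 : ∀ χ ∈ irredChars G, ∑ g, f g * χ g = 0) : f = 0 := by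
  classical
  let z : ℂ[G] := ∑ g, MonoidAlgebra.single g (f g)
  have key : ∀ S : Submodule ℂ[G] ℂ[G], IsSimpleModule ℂ[G] S → ∀ s ∈ S, z * s = 0 := by
    intro S hS s hs
    exact congrArg Subtype.val (aux_simple f hf h0 S ⟨s, hs⟩)
  have hall : ∀ x : ℂ[G], z * x = 0 := by
    intro x
    have hx : x ∈ sSup {S : Submodule ℂ[G] ℂ[G] | IsSimpleModule ℂ[G] S} := by
      rw [IsSemisimpleModule.sSup_simples_eq_top]; trivial
    rw [sSup_eq_iSup'] at hx
    induction hx using Submodule.iSup_induction' with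
    | mem i x hx => exact key i.1 i.2 x hx
    | zero => simp
    | add x y _ _ h1 h2 => rw [mul_add, h1, h2, add_zero]
  have hz := hall 1
  rw [mul_one] at hz
  funext g
  have := congrArg (fun w : ℂ[G] => w.coeff g) hz
  simpa [z, Finsupp.single_apply] using this

lemma aux_orth {G : Type} [Group G] [Fintype G] [DecidableEq (G → ℂ)] {χ ψ : G → ℂ}
    (hχ : χ ∈ irredChars G) (hψ : ψ ∈ irredChars G) :
    (Fintype.card G : ℂ)⁻¹ * ∑ g, χ g * ψ g⁻¹ = if χ = ψ then 1 else 0 := by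
  have := invertibleOfNonzero (NeZero.ne (Nat.card G : ℂ))
  obtain ⟨V, hV, rfl⟩ := hχ
  obtain ⟨W, hW, rfl⟩ := hψ
  by_cases h : V.character = W.character
  · rw [if_pos h, ← h]
    have := FDRep.char_orthonormal V V
    rw [if_pos ⟨Iso.refl V⟩] at this
    simpa using this
  · rw [if_neg h]
    have := FDRep.char_orthonormal V W
    rw [if_neg (fun ⟨i⟩ => h (FDRep.char_iso i))] at this
    simpa using this

lemma aux_finite (G : Type) [Group G] [Fintype G] : (irredChars G).Finite := by
  classical
  have hli : LinearIndependent ℂ (fun χ : irredChars G => (χ : G → ℂ)) := by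
    rw [linearIndependent_iff']
    intro s c hc i hi
    have h : ∑ j ∈ s, c j * ((Fintype.card G : ℂ)⁻¹ * ∑ g, j.1 g * i.1 g⁻¹) = 0 := by
      have : ∀ g, ∑ j ∈ s, c j * j.1 g = 0 := fun g => by
        simpa [Finset.sum_apply] using congrFun hc g
      calc _ = (Fintype.card G : ℂ)⁻¹ * ∑ g, (∑ j ∈ s, c j * j.1 g) * i.1 g⁻¹ := by
            simp only [Finset.mul_sum, Finset.sum_mul]
            rw [Finset.sum_comm]
            refine Finset.sum_congr rfl fun _ _ => Finset.sum_congr rfl fun _ _ => by ring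
        _ = 0 := by simp [this]
    simp only [aux_orth (Subtype.property _) i.2] at h
    simpa [Subtype.ext_iff.symm, hi] using h
  exact hli.setFinite

lemma aux_expand {G : Type} [Group G] [Fintype G] (f : G → ℂ)
    (hf : ∀ g h : G, f (h * g * h⁻¹) = f g) (g : G) :
    f g = ∑ χ ∈ (aux_finite G).toFinset,
      ((Fintype.card G : ℂ)⁻¹ * ∑ x, f x * χ x) * χ g⁻¹ := by
  classical
  have h := aux_complete (fun g => f g - ∑ χ ∈ (aux_finite G).toFinset,
      ((Fintype.card G : ℂ)⁻¹ * ∑ x, f x * χ x) * χ g⁻¹) ?_ ?_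
  · exact sub_eq_zero.mp (congrFun h g)
  · intro g h
    simp only [hf]
    congr 1
    refine Finset.sum_congr rfl fun χ hχ => ?_
    obtain ⟨V, hV, rfl⟩ := (aux_finite G).mem_toFinset.1 hχ
    have : (h * g * h⁻¹)⁻¹ = h * g⁻¹ * h⁻¹ := by group
    rw [this, FDRep.char_conj]
  · intro ψ hψ
    have hne : (Fintype.card G : ℂ) ≠ 0 := NeZero.ne _
    have : ∑ g, (∑ χ ∈ (aux_finite G).toFinset,
        ((Fintype.card G : ℂ)⁻¹ * ∑ x, f x * χ x) * χ g⁻¹) * ψ g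
        = ∑ χ ∈ (aux_finite G).toFinset, (∑ x, f x * χ x) *
          ((Fintype.card G : ℂ)⁻¹ * ∑ g, ψ g * χ g⁻¹) := by
      simp only [Finset.sum_mul (s := (aux_finite G).toFinset)]
      rw [Finset.sum_comm]
      refine Finset.sum_congr rfl fun χ _ => ?_
      rw [← mul_assoc, Finset.mul_sum (f := fun g => ψ g * χ g⁻¹)]
      refine Finset.sum_congr rfl fun _ _ => by ring
    simp only [sub_mul, Finset.sum_sub_distrib]
    have h2 : ∑ χ ∈ (aux_finite G).toFinset, (∑ x, f x * χ x) *
          ((Fintype.card G : ℂ)⁻¹ * ∑ g, ψ g * χ g⁻¹) =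
        ∑ χ ∈ (aux_finite G).toFinset, (∑ x, f x * χ x) * (if ψ = χ then 1 else 0) :=
      Finset.sum_congr rfl fun χ hχ => by
        rw [aux_orth hψ ((aux_finite G).mem_toFinset.1 hχ)]
    rw [this, h2]
    simp [hψ]

/-- Let `G` be a finite group, `a, b` positive integers, and
`Γ = ⟨x, y | x^a = y^b⟩`. Then `|Hom(Γ,G)| / |G| = Σ_χ ν_a(χ)·ν_b(χ)`, where
`ν_n(χ) = (1/|G|) Σ_{x∈G} χ(x^n)` is the `n`-th Frobenius–Schur indicator and the sum runs
over irreducible complex characters of `G`; `Hom(Γ,G)` is identified with the set of pairs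
`(X,Y) ∈ G²` with `X^a = Y^b`. -/
theorem stmt9 (G : Type) [Group G] [Fintype G] (a b : ℕ) (ha : 0 < a) (hb : 0 < b) :
    (Nat.card {p : G × G // p.1 ^ a = p.2 ^ b} : ℂ) / (Fintype.card G : ℂ) =
      ∑ᶠ f ∈ irredChars G,
        ((1 / (Fintype.card G : ℂ)) * ∑ x : G, f (x ^ a)) *
        ((1 / (Fintype.card G : ℂ)) * ∑ x : G, f (x ^ b)) := by
  classical
  have hne : (Fintype.card G : ℂ) ≠ 0 := NeZero.ne _
  rw [finsum_mem_eq_finite_toFinset_sum _ (aux_finite G)]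
  let r : G → ℂ := fun g => ∑ x : G, if x ^ a = g then 1 else 0
  have hr : ∀ g h : G, r (h * g * h⁻¹) = r g := by
    intro g h
    symm
    refine Fintype.sum_equiv (MulAut.conj h).toEquiv _ _ fun x => ?_
    simp [conj_pow]
  have hrχ : ∀ χ : G → ℂ, ∑ g, r g * χ g = ∑ x : G, χ (x ^ a) := by
    intro χ
    simp only [r, Finset.sum_mul]
    rw [Finset.sum_comm]
    simp
  have hcard : (Nat.card {p : G × G // p.1 ^ a = p.2 ^ b} : ℂ) = ∑ y : G, r (y ^ b) := by
    rw [Nat.card_eq_fintype_card, Fintype.card_subtype, Finset.card_filter]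
    push_cast
    rw [Fintype.sum_prod_type, Finset.sum_comm]
  rw [hcard, Finset.sum_congr rfl fun y _ => aux_expand r hr (y ^ b), Finset.sum_comm,
    Finset.sum_div]
  refine Finset.sum_congr rfl fun χ _ => ?_
  rw [← Finset.mul_sum, hrχ]
  have : ∑ y : G, χ (y ^ b)⁻¹ = ∑ y : G, χ (y ^ b) := by
    refine Fintype.sum_equiv (Equiv.inv G) _ _ fun y => ?_
    simp
  rw [this]
  field_simp
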